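/- For 1 ≤ i ≤ m and b ∈ ℤ define the operator F_i(b) on F_N(S) by F_i(b) := Σ_{r∈S} q^{−br} Σ_{k=1}^{n} :psi_i^k(−r) psibar_i^k(r): − n·ω_S(b)·Id. Then for every 1 ≤ l ≤ n: F_i(b)(B_l|0⟩) = ( Σ_{r∈J^S_{i,lbar1}} q^{−br} − Σ_{r∈Jbar^S_{i,lbar2}} q^{−br} + εn − nω_S(b) ) B_l|0⟩. -/

import Mathlib

noncomputable section

/-- Context for the enlarged Weyl algebra `W_N(S)` with `N = m·n` and
`S = ℤ` (encoded by `sig = 0`) or `S = ℤ + 1/2` (encoded by `sig = 1`).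
An element `r ∈ S` is encoded by the unique integer `k` with `r = k + sig/2`,
so that `ε := 1/2 - sig/2` and e.g. `r > 0 ↔ 0 < 2k + sig`.
The data also fixes a generic `q ∈ ℂˣ` together with a square root `sq` of `q`. -/
structure WCtx where
  m : ℕ
  n : ℕ
  hm : 0 < m
  hn : 0 < n
  sig : ℤ
  hsig : sig = 0 ∨ sig = 1
  q : ℂ
  sq : ℂ
  hsq : sq ^ 2 = q
  hq0 : q ≠ 0
  hqu : ∀ k : ℕ, k ≠ 0 → q ^ k ≠ 1

namespace WCtx

variable (C : WCtx)

/-- `N = m n`. -/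
def NN : ℕ := C.m * C.n

/-- Names of the generators of `W_N(S)`: `Sum.inl i` is `ψ_{i+1}` and
`Sum.inr i` is `ψ̄_{i+1}`; the integer `k` encodes the index `r = k + sig/2 ∈ S`. -/
abbrev Gen : Type := (Fin C.NN ⊕ Fin C.NN) × ℤ

/-- The defining relations of the enlarged Weyl algebra `W_N(S)`:
any two `ψ`'s commute, any two `ψ̄`'s commute, and
`ψ̄_i(k)ψ_j(r) − ψ_j(r)ψ̄_i(k) = δ_{i,j} δ_{k+r,0}`. -/
inductive rel : FreeAlgebra ℂ C.Gen → FreeAlgebra ℂ C.Gen → Prop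
  | comm_psi (i j : Fin C.NN) (k l : ℤ) :
      rel (FreeAlgebra.ι ℂ ((Sum.inl i, k) : C.Gen) * FreeAlgebra.ι ℂ ((Sum.inl j, l) : C.Gen))
          (FreeAlgebra.ι ℂ ((Sum.inl j, l) : C.Gen) * FreeAlgebra.ι ℂ ((Sum.inl i, k) : C.Gen))
  | comm_psibar (i j : Fin C.NN) (k l : ℤ) :
      rel (FreeAlgebra.ι ℂ ((Sum.inr i, k) : C.Gen) * FreeAlgebra.ι ℂ ((Sum.inr j, l) : C.Gen))
          (FreeAlgebra.ι ℂ ((Sum.inr j, l) : C.Gen) * FreeAlgebra.ι ℂ ((Sum.inr i, k) : C.Gen))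
  | mixed (i j : Fin C.NN) (k l : ℤ) :
      rel (FreeAlgebra.ι ℂ ((Sum.inr i, k) : C.Gen) * FreeAlgebra.ι ℂ ((Sum.inl j, l) : C.Gen))
          (FreeAlgebra.ι ℂ ((Sum.inl j, l) : C.Gen) * FreeAlgebra.ι ℂ ((Sum.inr i, k) : C.Gen)
            + (if i = j ∧ k + l + C.sig = 0 then 1 else 0))

/-- The enlarged Weyl algebra `W_N(S)`. -/
def W : Type := RingQuot C.rel

instance : Ring C.W := inferInstanceAs (Ring (RingQuot C.rel))
instance : Algebra ℂ C.W := inferInstanceAs (Algebra ℂ (RingQuot C.rel))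

/-- `ψ` with `0`-indexed flat subscript. -/
def psi0 (i : Fin C.NN) (k : ℤ) : C.W :=
  RingQuot.mkAlgHom ℂ C.rel (FreeAlgebra.ι ℂ ((Sum.inl i, k) : C.Gen))

/-- `ψ̄` with `0`-indexed flat subscript. -/
def psibar0 (i : Fin C.NN) (k : ℤ) : C.W :=
  RingQuot.mkAlgHom ℂ C.rel (FreeAlgebra.ι ℂ ((Sum.inr i, k) : C.Gen))

/-- `ψ_i(r)` with `1`-indexed flat subscript `i ∈ {1,…,N}` (junk value `0` outside). -/
def psiF (i : ℕ) (k : ℤ) : C.W :=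
  if h : 1 ≤ i ∧ i ≤ C.NN then C.psi0 ⟨i - 1, by omega⟩ k else 0

/-- `ψ̄_i(r)` with `1`-indexed flat subscript `i ∈ {1,…,N}` (junk value `0` outside). -/
def psibarF (i : ℕ) (k : ℤ) : C.W :=
  if h : 1 ≤ i ∧ i ≤ C.NN then C.psibar0 ⟨i - 1, by omega⟩ k else 0

/-- `ψ_i^c(r) = ψ_{i+(c-1)m}(r)`, subscript `i ∈ {1,…,m}`, superscript `c ∈ {1,…,n}`. -/
def psiS (i c : ℕ) (k : ℤ) : C.W := C.psiF (i + (c - 1) * C.m) k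

/-- `ψ̄_i^c(r) = ψ̄_{i+(c-1)m}(r)`. -/
def psibarS (i c : ℕ) (k : ℤ) : C.W := C.psibarF (i + (c - 1) * C.m) k

/-- The left ideal of `W_N(S)` generated by all `ψ_i(r), ψ̄_i(r)` with `r > 0`,
together with all `ψ̄_i(0)` when `S = ℤ`. -/
def vacIdeal : Submodule C.W C.W :=
  Submodule.span C.W
    {w : C.W |
      (∃ (i : Fin C.NN) (k : ℤ), 0 < 2 * k + C.sig ∧ (w = C.psi0 i k ∨ w = C.psibar0 i k)) ∨
        (C.sig = 0 ∧ ∃ i : Fin C.NN, w = C.psibar0 i 0)}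

/-- The Fock module `F_N(S) = W_N(S)/I`. -/
def F : Type := C.W ⧸ C.vacIdeal

instance : AddCommGroup C.F := inferInstanceAs (AddCommGroup (C.W ⧸ C.vacIdeal))
instance : Module C.W C.F := inferInstanceAs (Module C.W (C.W ⧸ C.vacIdeal))
instance : Module ℂ C.F := inferInstanceAs (Module ℂ (C.W ⧸ C.vacIdeal))

/-- The vacuum vector `|0⟩ ∈ F_N(S)`. -/
def vac : C.F := Submodule.Quotient.mk (1 : C.W)

/-- Normal ordering `:u(k) v(l):` where `l` encodes the `S`-index of the second factor. -/
def nord (u : C.W) (l : ℤ) (v : C.W) : C.W :=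
  if 0 < 2 * l + C.sig then u * v
  else if 2 * l + C.sig = 0 then (2 : ℂ)⁻¹ • (u * v + v * u)
  else v * u

/-- `ε = 0` if `S = ℤ + 1/2`, `ε = 1/2` if `S = ℤ`, as a complex number. -/
def eps : ℂ := (1 - (C.sig : ℂ)) / 2

/-- `ω_S(b)`. -/
def om (b : ℤ) : ℂ :=
  if b = 0 then 0
  else if C.sig = 0 then (2 : ℂ)⁻¹ * ((C.q ^ b + 1) / (C.q ^ b - 1))
  else C.sq ^ b / (C.q ^ b - 1)

/-- `q^{-b r}` for `r = k + sig/2 ∈ S`. -/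
def qp (b k : ℤ) : ℂ := C.sq ^ (-(b * (2 * k + C.sig)))

/-- `q^{b r}` for `r = k + sig/2 ∈ S`. -/
def qpp (b k : ℤ) : ℂ := C.sq ^ (b * (2 * k + C.sig))

/-- `φ^c_{t + sig/2}`; here `t ∈ ℤ` encodes the half-integer index `t + sig/2 = t + 1/2 - ε`.
Writing `t = (k + sig)m - i` with `1 ≤ i ≤ m`, `k ∈ ℤ`, this is `ψ_i^c(k + sig/2)`. -/
def PhiW (c : ℕ) (t : ℤ) : C.W :=
  C.psiF ((((-t - 1).emod C.m).toNat + 1) + (c - 1) * C.m)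
    ((t + (-t - 1).emod C.m + 1) / C.m - C.sig)

/-- `φ̄^c_{t + sig/2}`; writing `t = k·m + i - 1` with `1 ≤ i ≤ m`, `k ∈ ℤ`,
this is `ψ̄_i^c(k + sig/2)`. -/
def PhibarW (c : ℕ) (t : ℤ) : C.W :=
  C.psibarF (((t.emod C.m).toNat + 1) + (c - 1) * C.m) ((t - t.emod C.m) / C.m)

/-- Determinant of a square matrix with (pairwise commuting) entries in `W_N(S)`. -/
def ncdet {l : ℕ} (M : Fin l → Fin l → C.W) : C.W :=
  ∑ p : Equiv.Perm (Fin l),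
    (((Equiv.Perm.sign p : ℤˣ) : ℤ)) • ((List.finRange l).map fun t => M (p t) t).prod

/-- The element `A_l ∈ W_N(S)`, `1 ≤ l ≤ n`. -/
def Adet (l : ℕ) : C.W :=
  C.ncdet fun k t : Fin l => C.PhiW ((k : ℕ) + 1) (-(((t : ℕ) : ℤ) + 1))

/-- The element `Ā_l ∈ W_N(S)`, `1 ≤ l ≤ n`. -/
def Abar (l : ℕ) : C.W :=
  C.ncdet fun s t : Fin (C.n - l + 1) => C.PhibarW (C.n - (s : ℕ)) (-(((t : ℕ) : ℤ) + 1))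

/-- `α(r,a,i) = (a - r + 1/2 - ε)m - i + 1 = (a-k)m - i + 1` for `r = k + sig/2`. -/
def alphaV (k a : ℤ) (i : ℕ) : ℤ := (a - k) * C.m - (i : ℤ) + 1

/-- `β(r,a,j) = (r + a - 1/2 + ε)m + j = (k+a)m + j` for `r = k + sig/2`. -/
def betaV (k a : ℤ) (j : ℕ) : ℤ := (k + a) * C.m + (j : ℤ)

/-- `Σ_{c=1}^{n} ψ_i^c(a-r) ψ̄_j^c(r)`, where `k` encodes `r`. -/
def Esum (i j : ℕ) (a k : ℤ) : C.W :=
  ∑ c : Fin C.n, C.psiS i ((c : ℕ) + 1) (a - k - C.sig) * C.psibarS j ((c : ℕ) + 1) k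

/-- `A_l^{i,j,r}`: `A_l` with the `β(r,0,j)`-th column replaced by
`(φ^1_{α(r,a,i)-1/2-ε}, …, φ^l_{α(r,a,i)-1/2-ε})ᵗ`. -/
def Amod (l : ℕ) (i j : ℕ) (a k : ℤ) : C.W :=
  C.ncdet fun r t : Fin l =>
    if (((t : ℕ) : ℤ) + 1) = C.betaV k 0 j then C.PhiW ((r : ℕ) + 1) (C.alphaV k a i - 1)
    else C.PhiW ((r : ℕ) + 1) (-(((t : ℕ) : ℤ) + 1))

/-- `Ā_l^{i,j,r}`: `Ā_l` with the `α(r,a,i)`-th column replaced by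
`(-φ̄^n_{β(r,0,j)-1/2-ε}, …, -φ̄^l_{β(r,0,j)-1/2-ε})ᵗ`. -/
def Abarmod (l : ℕ) (i j : ℕ) (a k : ℤ) : C.W :=
  C.ncdet fun s t : Fin (C.n - l + 1) =>
    if (((t : ℕ) : ℤ) + 1) = C.alphaV k a i then -C.PhibarW (C.n - (s : ℕ)) (C.betaV k 0 j - 1)
    else C.PhibarW (C.n - (s : ℕ)) (-(((t : ℕ) : ℤ) + 1))

/-- `l̄₁` for `l = l₁ m + l₂`, `1 ≤ l₂ ≤ m`. -/
def lb1 (l : ℕ) : ℕ :=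
  if (l - 1) / C.m % 2 = 0 then ((l - 1) / C.m / 2) * C.m + ((l - 1) % C.m + 1)
  else (((l - 1) / C.m + 1) / 2) * C.m

/-- `l̄₂ = l - l̄₁`. -/
def lb2 (l : ℕ) : ℕ := l - C.lb1 l

/-- The `(k,t)` entry of the matrix defining `B_l`. -/
def Bentry (l : ℕ) (k t : Fin l) : C.W :=
  if (t : ℕ) + 1 ≤ C.lb1 l then C.PhiW ((k : ℕ) + 1) (-(((t : ℕ) : ℤ) + 1))
  else C.PhibarW (C.n - (k : ℕ)) (-((((t : ℕ) : ℤ) + 1) - (C.lb1 l : ℤ)))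

/-- The element `B_l ∈ W_N(S)`, `1 ≤ l ≤ n`. -/
def Bdet (l : ℕ) : C.W := C.ncdet (C.Bentry l)

/-- The element `B̄_{n/2} ∈ W_N(S)` (`n` even): `B_{n/2}` with its `(n/2)`-th row replaced. -/
def Bbar : C.W :=
  C.ncdet fun k t : Fin (C.n / 2) =>
    if (k : ℕ) + 1 = C.n / 2 then
      (if (t : ℕ) + 1 ≤ C.lb1 (C.n / 2) then C.PhiW (C.n / 2 + 1) (-(((t : ℕ) : ℤ) + 1))
       else C.PhibarW (C.n / 2) (-((((t : ℕ) : ℤ) + 1) - (C.lb1 (C.n / 2) : ℤ))))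
    else C.Bentry (C.n / 2) k t

/-- `B_l` with its `pos`-th column replaced by the column `(col 1, …, col l)ᵗ`. -/
def Bcolrep (l : ℕ) (pos : ℤ) (col : ℕ → C.W) : C.W :=
  C.ncdet fun k t : Fin l =>
    if (((t : ℕ) : ℤ) + 1) = pos then col ((k : ℕ) + 1) else C.Bentry l k t

/-- The operator `T_{i,j}(a,b) = Σ_{r∈S} q^{-br} Σ_{c=1}^n :ψ_i^c(a-r) ψ̄_j^c(r):`. -/
def Top (i j : ℕ) (a b : ℤ) (x : C.F) : C.F :=
  ∑ᶠ k : ℤ, (C.qp b k • ∑ c : Fin C.n,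
    C.nord (C.psiS i ((c : ℕ) + 1) (a - k - C.sig)) k (C.psibarS j ((c : ℕ) + 1) k)) • x

/-- The operator `S_{i,j}(c,d) = Σ_{e=1}^n ψ_i^e(c) ψ̄_j^e(d)`. -/
def Sop (i j : ℕ) (c d : ℤ) (x : C.F) : C.F :=
  (∑ e : Fin C.n, C.psiS i ((e : ℕ) + 1) c * C.psibarS j ((e : ℕ) + 1) d) • x

/-- The operator `E_{p,p} = Σ_{c=1}^m Σ_{r∈S} :ψ_c^p(-r) ψ̄_c^p(r): − ε m`. -/
def Epp (p : ℕ) (x : C.F) : C.F :=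
  (∑ᶠ k : ℤ, (∑ c : Fin C.m,
      C.nord (C.psiS ((c : ℕ) + 1) p (-k - C.sig)) k (C.psibarS ((c : ℕ) + 1) p k)) • x)
    - (C.eps * (C.m : ℂ)) • x

/-- The operator `E_i(b) = Σ_{r∈S} q^{-br} Σ_{c=1}^n :ψ_i^c(-r) ψ̄_i^c(r): − n ω_S(b)`. -/
def Eib (i : ℕ) (b : ℤ) (x : C.F) : C.F :=
  (∑ᶠ k : ℤ, (C.qp b k • ∑ c : Fin C.n,
      C.nord (C.psiS i ((c : ℕ) + 1) (-k - C.sig)) k (C.psibarS i ((c : ℕ) + 1) k)) • x)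
    - ((C.n : ℂ) * C.om b) • x

/-- `Σ_{r ∈ J^S_{i,l}} q^{-br}`. -/
def Jsum (i l : ℕ) (b : ℤ) : ℂ :=
  ∑ᶠ k ∈ {k : ℤ | 1 ≤ k * (C.m : ℤ) + (i : ℤ) ∧ k * (C.m : ℤ) + (i : ℤ) ≤ (l : ℤ)}, C.qp b k

/-- `Σ_{r ∈ J̄^S_{i,l}} q^{-br}`. -/
def Jbarsum (i l : ℕ) (b : ℤ) : ℂ :=
  ∑ᶠ k ∈ {k : ℤ | 1 ≤ -(k * (C.m : ℤ)) - (i : ℤ) + 1 ∧ -(k * (C.m : ℤ)) - (i : ℤ) + 1 ≤ (l : ℤ)},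
    C.qp b k

/-- `Σ_{r ∈ J^S_{i,l}} q^{br}`. -/
def JsumP (i l : ℕ) (b : ℤ) : ℂ :=
  ∑ᶠ k ∈ {k : ℤ | 1 ≤ k * (C.m : ℤ) + (i : ℤ) ∧ k * (C.m : ℤ) + (i : ℤ) ≤ (l : ℤ)}, C.qpp b k

/-- `Σ_{c=1}^m ψ_c^p(-r) ψ̄_c^{p+1}(r)` (no normal ordering), `k` encoding `r ∈ S`. -/
def glRaise (p : ℕ) (k : ℤ) : C.W :=
  ∑ c : Fin C.m, C.psiS ((c : ℕ) + 1) p (-k - C.sig) * C.psibarS ((c : ℕ) + 1) (p + 1) k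

/-- The operator `Σ_{c=1}^m Σ_{r∈S} :ψ_c^p(-r) ψ̄_c^{p+1}(r):`. -/
def glRaiseOp (p : ℕ) (x : C.F) : C.F :=
  ∑ᶠ k : ℤ, (∑ c : Fin C.m,
    C.nord (C.psiS ((c : ℕ) + 1) p (-k - C.sig)) k (C.psibarS ((c : ℕ) + 1) (p + 1) k)) • x

end WCtx

namespace WCtx

variable (C : WCtx)

instance : IsScalarTower ℂ C.W C.F :=
  inferInstanceAs (IsScalarTower ℂ C.W (C.W ⧸ C.vacIdeal))

theorem psi0_comm (i j : Fin C.NN) (k l : ℤ) :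
    C.psi0 i k * C.psi0 j l = C.psi0 j l * C.psi0 i k := by
  have h := RingQuot.mkAlgHom_rel ℂ (rel.comm_psi (C := C) i j k l)
  rw [map_mul, map_mul] at h
  exact h

theorem psibar0_comm (i j : Fin C.NN) (k l : ℤ) :
    C.psibar0 i k * C.psibar0 j l = C.psibar0 j l * C.psibar0 i k := by
  have h := RingQuot.mkAlgHom_rel ℂ (rel.comm_psibar (C := C) i j k l)
  rw [map_mul, map_mul] at h
  exact h

theorem psibar0_mul_psi0 (i j : Fin C.NN) (k l : ℤ) :
    C.psibar0 i k * C.psi0 j l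
      = C.psi0 j l * C.psibar0 i k + if i = j ∧ k + l + C.sig = 0 then 1 else 0 := by
  have h := RingQuot.mkAlgHom_rel ℂ (rel.mixed (C := C) i j k l)
  rw [map_add, map_mul, map_mul] at h
  refine h.trans ?_
  congr 1
  split_ifs
  · exact map_one (RingQuot.mkAlgHom ℂ C.rel)
  · exact map_zero (RingQuot.mkAlgHom ℂ C.rel)

theorem psiF_comm (i j : ℕ) (k l : ℤ) :
    C.psiF i k * C.psiF j l = C.psiF j l * C.psiF i k := by
  unfold psiF
  split_ifs <;> simp [psi0_comm C]

theorem psibarF_comm (i j : ℕ) (k l : ℤ) :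
    C.psibarF i k * C.psibarF j l = C.psibarF j l * C.psibarF i k := by
  unfold psibarF
  split_ifs <;> simp [psibar0_comm C]

theorem psibarF_mul_psiF {i j : ℕ} (hi : 1 ≤ i ∧ i ≤ C.NN) (hj : 1 ≤ j ∧ j ≤ C.NN) (k l : ℤ) :
    C.psibarF i k * C.psiF j l
      = C.psiF j l * C.psibarF i k + if i = j ∧ k + l + C.sig = 0 then 1 else 0 := by
  unfold psibarF psiF
  rw [dif_pos hi, dif_pos hj, psibar0_mul_psi0]
  have : (i - 1 = j - 1) ↔ i = j := by omega
  simp only [Fin.mk.injEq, this]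

theorem index_bounds {i c : ℕ} (hi : 1 ≤ i) (hi' : i ≤ C.m) (hc : c < C.n) :
    1 ≤ i + (c + 1 - 1) * C.m ∧ i + (c + 1 - 1) * C.m ≤ C.NN := by
  refine ⟨by omega, ?_⟩
  have : (c + 1) * C.m ≤ C.n * C.m := Nat.mul_le_mul_right _ hc
  unfold NN
  rw [Nat.mul_comm C.m C.n]
  rw [Nat.add_sub_cancel]
  linarith

theorem psiF_vac (i : ℕ) {k : ℤ} (hk : 0 < 2 * k + C.sig) : C.psiF i k • C.vac = 0 := by
  unfold psiF
  split_ifs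
  · refine (Submodule.Quotient.mk_eq_zero C.vacIdeal).2 (Submodule.subset_span ?_)
    refine Or.inl ⟨_, k, hk, Or.inl (mul_one _)⟩
  · exact zero_smul _ _

theorem psibarF_vac (i : ℕ) {k : ℤ} (hk : 0 ≤ 2 * k + C.sig) : C.psibarF i k • C.vac = 0 := by
  unfold psibarF
  split_ifs
  · refine (Submodule.Quotient.mk_eq_zero C.vacIdeal).2 (Submodule.subset_span ?_)
    rcases hk.lt_or_eq with hk | hk
    · exact Or.inl ⟨_, k, hk, Or.inr (mul_one _)⟩
    · have h0 : C.sig = 0 ∧ k = 0 := by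
        rcases C.hsig with h | h <;> omega
      obtain ⟨h, rfl⟩ := h0
      exact Or.inr ⟨h, _, mul_one _⟩
  · exact zero_smul _ _

/-- The mode `Σ_c :ψ_i^c(-r) ψ̄_i^c(r):` of the current, with `k` encoding `r`. -/
def currentMode (i : ℕ) (k : ℤ) : C.W :=
  ∑ c : Fin C.n, C.nord (C.psiS i ((c : ℕ) + 1) (-k - C.sig)) k (C.psibarS i ((c : ℕ) + 1) k)

theorem nord_eq_mul_add {u v : C.W} (h : v * u = u * v + 1) (k : ℤ) :
    ∃ z : ℂ, C.nord u k v = u * v + z • 1 := by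
  unfold nord
  split_ifs
  · exact ⟨0, by simp⟩
  · refine ⟨2⁻¹, ?_⟩
    rw [h, ← add_assoc, smul_add, ← two_smul ℂ (u * v), smul_smul]
    norm_num
  · exact ⟨1, by rw [h, one_smul]⟩

theorem psibarS_mul_psiS_self {i c : ℕ} (hi : 1 ≤ i) (hi' : i ≤ C.m) (hc : c < C.n) (k : ℤ) :
    C.psibarS i (c + 1) k * C.psiS i (c + 1) (-k - C.sig)
      = C.psiS i (c + 1) (-k - C.sig) * C.psibarS i (c + 1) k + 1 := by
  have h := C.index_bounds hi hi' hc
  unfold psibarS psiS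
  rw [psibarF_mul_psiF C h h, if_pos ⟨rfl, by ring⟩]

theorem currentMode_vac {i : ℕ} (hi : 1 ≤ i) (hi' : i ≤ C.m) (k : ℤ) :
    C.currentMode i k • C.vac = (if k = 0 then C.eps * (C.n : ℂ) else 0) • C.vac := by
  have key : ∀ c : Fin C.n,
      C.nord (C.psiS i ((c : ℕ) + 1) (-k - C.sig)) k (C.psibarS i ((c : ℕ) + 1) k) • C.vac
        = (if k = 0 then C.eps else 0) • C.vac := by
    intro c
    rcases lt_trichotomy 0 (2 * k + C.sig) with h | h | h
    · rw [nord, if_pos h, mul_smul, psibarS, C.psibarF_vac _ h.le, smul_zero]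
      split_ifs with hk
      · have hs : C.sig = 1 := by rcases C.hsig with h' | h' <;> omega
        simp [eps, hs]
      · rw [zero_smul]
    · have hs : C.sig = 0 ∧ k = 0 := by rcases C.hsig with h' | h' <;> omega
      rw [nord, if_neg h.not_lt, if_pos h.symm, C.psibarS_mul_psiS_self hi hi' c.2, smul_assoc,
        add_smul, add_smul, mul_smul, psibarS, C.psibarF_vac _ h.le, smul_zero, one_smul,
        zero_add, zero_add, if_pos hs.2]
      simp [eps, hs.1]
    · rw [nord, if_neg h.not_gt, if_neg h.ne, mul_smul, psiS, C.psiF_vac _ (by omega), smul_zero,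
        if_neg (by rcases C.hsig with h' | h' <;> omega), zero_smul]
  rw [currentMode, Finset.sum_smul, Finset.sum_congr rfl fun c _ => key c, Finset.sum_const,
    Finset.card_univ, Fintype.card_fin, ← Nat.cast_smul_eq_nsmul ℂ, smul_smul]
  split_ifs
  · rw [mul_comm]
  · rw [mul_zero]

theorem mul_mul_psiF {i j : ℕ} (hi : 1 ≤ i ∧ i ≤ C.NN) (hj : 1 ≤ j ∧ j ≤ C.NN) (k s : ℤ) :
    C.psiF i (-k - C.sig) * C.psibarF i k * C.psiF j s
      = C.psiF j s * (C.psiF i (-k - C.sig) * C.psibarF i k)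
        + (if i = j ∧ k + s + C.sig = 0 then (1 : ℂ) else 0) • C.psiF j s := by
  rw [mul_assoc, C.psibarF_mul_psiF hi hj, mul_add, ← mul_assoc, C.psiF_comm i j, mul_assoc]
  congr 1
  split_ifs with h
  · obtain ⟨rfl, h⟩ := h
    rw [mul_one, one_smul, show s = -k - C.sig by omega]
  · simp

theorem mul_mul_psibarF {i j : ℕ} (hi : 1 ≤ i ∧ i ≤ C.NN) (hj : 1 ≤ j ∧ j ≤ C.NN) (k s : ℤ) :
    C.psiF i (-k - C.sig) * C.psibarF i k * C.psibarF j s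
      = C.psibarF j s * (C.psiF i (-k - C.sig) * C.psibarF i k)
        + (if i = j ∧ s = k then (-1 : ℂ) else 0) • C.psibarF j s := by
  rw [mul_assoc, C.psibarF_comm i j, ← mul_assoc, ← mul_assoc, C.psibarF_mul_psiF hj hi, add_mul]
  by_cases h : i = j ∧ s = k
  · obtain ⟨rfl, rfl⟩ := h
    rw [if_pos ⟨rfl, by ring⟩, if_pos ⟨rfl, rfl⟩]
    simp
  · rw [if_neg h, if_neg fun h' => h ⟨h'.1.symm, by omega⟩]
    simp

/-- If `x` has weight `w c` under each `ψ_i^c(-r) ψ̄_i^c(r)`, then it has weight `Σ_c w c` under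
the mode of the current. -/
theorem currentMode_mul {i : ℕ} (hi : 1 ≤ i) (hi' : i ≤ C.m) (k : ℤ) (x : C.W)
    (w : Fin C.n → ℂ)
    (h : ∀ c : Fin C.n, C.psiS i ((c : ℕ) + 1) (-k - C.sig) * C.psibarS i ((c : ℕ) + 1) k * x
      = x * (C.psiS i ((c : ℕ) + 1) (-k - C.sig) * C.psibarS i ((c : ℕ) + 1) k) + w c • x) :
    C.currentMode i k * x = x * C.currentMode i k + (∑ c, w c) • x := by
  rw [currentMode, Finset.sum_mul, Finset.mul_sum, Finset.sum_smul, ← Finset.sum_add_distrib]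
  refine Finset.sum_congr rfl fun c _ => ?_
  obtain ⟨z, hz⟩ := C.nord_eq_mul_add (C.psibarS_mul_psiS_self hi hi' c.2 k) k
  rw [hz, add_mul, h c, mul_add]
  simp only [smul_mul_assoc, one_mul, mul_smul_comm, mul_one]
  abel

theorem PhiW_eq (c : ℕ) (t : ℤ) :
    C.PhiW c t = C.psiF (((-t - 1) % C.m).toNat + 1 + (c - 1) * C.m)
      (-((-t - 1) / C.m) - C.sig) := by
  have hm : (C.m : ℤ) ≠ 0 := by exact_mod_cast C.hm.ne'
  have h : (t + (-t - 1) % C.m + 1) / C.m = -((-t - 1) / C.m) := by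
    have := Int.emod_add_mul_ediv (-t - 1) C.m
    rw [show t + (-t - 1) % C.m + 1 = C.m * -((-t - 1) / (C.m : ℤ)) by linarith,
      Int.mul_ediv_cancel_left _ hm]
  rw [← h]
  rfl

theorem PhibarW_eq (c : ℕ) (t : ℤ) :
    C.PhibarW c t = C.psibarF ((t % C.m).toNat + 1 + (c - 1) * C.m) (t / C.m) := by
  have hm : (C.m : ℤ) ≠ 0 := by exact_mod_cast C.hm.ne'
  have h : (t - t % C.m) / C.m = t / C.m := by
    have := Int.emod_add_mul_ediv t C.m
    rw [show t - t % C.m = C.m * (t / (C.m : ℤ)) by linarith, Int.mul_ediv_cancel_left _ hm]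
  rw [← h]
  rfl

theorem index_eq_iff {i : ℕ} (hi : 1 ≤ i) (hi' : i ≤ C.m) (u k : ℤ) (c d : ℕ) :
    (i + (c + 1 - 1) * C.m = (u % C.m).toNat + 1 + (d + 1 - 1) * C.m ∧ u / C.m = k)
      ↔ (k * C.m + i = u + 1 ∧ c = d) := by
  have hm : (0 : ℤ) < C.m := by exact_mod_cast C.hm
  have h0 := Int.emod_nonneg u hm.ne'
  have h1 := Int.emod_lt_of_pos u hm
  have h2 := Int.emod_add_mul_ediv u C.m
  obtain ⟨a, ha⟩ := Int.eq_ofNat_of_zero_le h0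
  simp only [Nat.add_sub_cancel]
  constructor
  · rintro ⟨h, rfl⟩
    rw [ha, Int.toNat_natCast] at h
    have hcd : c = d := by
      have e : (i - 1 + c * C.m) / C.m = (a + d * C.m) / C.m := by congr 1; omega
      rwa [Nat.add_mul_div_right _ _ C.hm, Nat.add_mul_div_right _ _ C.hm,
        Nat.div_eq_of_lt (by omega), Nat.div_eq_of_lt (by omega), zero_add, zero_add] at e
    subst hcd
    refine ⟨?_, rfl⟩
    have : i = a + 1 := by omega
    rw [this]
    push_cast
    linarith
  · rintro ⟨h, rfl⟩
    have hu : u = (i - 1 : ℤ) + k * C.m := by linarith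
    have e1 : u / C.m = k := by
      rw [hu, Int.add_mul_ediv_right _ _ hm.ne', Int.ediv_eq_zero_of_lt (by omega) (by omega),
        zero_add]
    refine ⟨?_, e1⟩
    have e2 : u % C.m = i - 1 := by
      rw [hu, Int.add_mul_emod_self_right, Int.emod_eq_of_lt (by omega) (by omega)]
    rw [e2]
    omega

theorem emod_toNat_bounds (u : ℤ) : 1 ≤ (u % C.m).toNat + 1 ∧ (u % C.m).toNat + 1 ≤ C.m := by
  have hm : (0 : ℤ) < C.m := by exact_mod_cast C.hm
  have h0 := Int.emod_nonneg u hm.ne'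
  have h1 := Int.emod_lt_of_pos u hm
  omega

theorem currentMode_mul_PhiW {i : ℕ} (hi : 1 ≤ i) (hi' : i ≤ C.m) (k : ℤ) {d : ℕ}
    (hd : d < C.n) (t : ℤ) :
    C.currentMode i k * C.PhiW (d + 1) t
      = C.PhiW (d + 1) t * C.currentMode i k
        + (if k * C.m + i = -t then (1 : ℂ) else 0) • C.PhiW (d + 1) t := by
  have hb := C.emod_toNat_bounds (-t - 1)
  rw [PhiW_eq]
  refine (C.currentMode_mul hi hi' k _ _ fun c =>
    C.mul_mul_psiF (C.index_bounds hi hi' c.2) (C.index_bounds hb.1 hb.2 hd) k _).trans ?_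
  have e : ∀ c : Fin C.n,
      (i + ((c : ℕ) + 1 - 1) * C.m = ((-t - 1) % C.m).toNat + 1 + (d + 1 - 1) * C.m
        ∧ k + (-((-t - 1) / C.m) - C.sig) + C.sig = 0) ↔ (k * C.m + i = -t ∧ c = ⟨d, hd⟩) := by
    intro c
    rw [Fin.ext_iff, show -t = (-t - 1) + 1 by ring, ← C.index_eq_iff hi hi']
    simp only [add_sub_cancel_right]
    refine and_congr_right fun _ => ⟨fun h => by linarith, fun h => by linarith⟩
  simp only [e, ite_and]
  split_ifs <;> simp

theorem currentMode_mul_PhibarW {i : ℕ} (hi : 1 ≤ i) (hi' : i ≤ C.m) (k : ℤ) {d : ℕ}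
    (hd : d < C.n) (t : ℤ) :
    C.currentMode i k * C.PhibarW (d + 1) t
      = C.PhibarW (d + 1) t * C.currentMode i k
        + (if k * C.m + i = t + 1 then (-1 : ℂ) else 0) • C.PhibarW (d + 1) t := by
  have hb := C.emod_toNat_bounds t
  rw [PhibarW_eq]
  refine (C.currentMode_mul hi hi' k _ _ fun c =>
    C.mul_mul_psibarF (C.index_bounds hi hi' c.2) (C.index_bounds hb.1 hb.2 hd) k _).trans ?_
  have e : ∀ c : Fin C.n,
      (i + ((c : ℕ) + 1 - 1) * C.m = (t % C.m).toNat + 1 + (d + 1 - 1) * C.m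
        ∧ t / C.m = k) ↔ (k * C.m + i = t + 1 ∧ c = ⟨d, hd⟩) := by
    intro c
    rw [Fin.ext_iff, ← C.index_eq_iff hi hi']
  simp only [e, ite_and]
  split_ifs <;> simp

/-- The weight of the `t`-th column (counted from `0`) of the matrix defining `B_l`, when its
first `a` columns consist of `φ`'s. -/
def columnWeight (i : ℕ) (k : ℤ) (a t : ℕ) : ℂ :=
  if t < a then (if k * C.m + i = t + 1 then 1 else 0)
  else (if -(k * C.m) - i + 1 = (t : ℤ) - a + 1 then -1 else 0)

theorem currentMode_mul_Bentry {i : ℕ} (hi : 1 ≤ i) (hi' : i ≤ C.m) (k : ℤ) {l : ℕ}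
    (hl' : l ≤ C.n) (r t : Fin l) :
    C.currentMode i k * C.Bentry l r t
      = C.Bentry l r t * C.currentMode i k
        + C.columnWeight i k (C.lb1 l) t • C.Bentry l r t := by
  have hr := r.2
  unfold Bentry columnWeight
  by_cases ht : (t : ℕ) + 1 ≤ C.lb1 l
  · rw [if_pos ht, if_pos (by omega), C.currentMode_mul_PhiW hi hi' k (by omega)]
    rw [neg_neg]
  · rw [if_neg ht, if_neg (by omega), show C.n - (r : ℕ) = (C.n - r - 1) + 1 by omega,
      C.currentMode_mul_PhibarW hi hi' k (by omega)]
    congr 3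
    exact propext ⟨fun h => by linarith, fun h => by linarith⟩

theorem mul_list_prod_of_weight {A ι : Type*} [Ring A] [Algebra ℂ A] (D : A) (f : ι → A)
    (w : ι → ℂ) (h : ∀ j, D * f j = f j * D + w j • f j) (L : List ι) :
    D * (L.map f).prod = (L.map f).prod * D + (L.map w).sum • (L.map f).prod := by
  induction L with
  | nil => simp
  | cons j L ih =>
    simp only [List.map_cons, List.prod_cons, List.sum_cons]
    rw [← mul_assoc, h, add_mul, mul_assoc, ih, mul_add, add_smul, smul_mul_assoc,
      mul_smul_comm, mul_assoc]
    abel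

theorem currentMode_mul_Bdet {i : ℕ} (hi : 1 ≤ i) (hi' : i ≤ C.m) (k : ℤ) {l : ℕ}
    (hl' : l ≤ C.n) :
    C.currentMode i k * C.Bdet l
      = C.Bdet l * C.currentMode i k
        + (∑ t ∈ Finset.range l, C.columnWeight i k (C.lb1 l) t) • C.Bdet l := by
  rw [Bdet, ncdet, Finset.mul_sum, Finset.sum_mul, Finset.smul_sum, ← Finset.sum_add_distrib]
  refine Finset.sum_congr rfl fun p _ => ?_
  rw [mul_smul_comm, mul_list_prod_of_weight _ _ (fun t : Fin l => C.columnWeight i k (C.lb1 l) t)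
    (fun t => C.currentMode_mul_Bentry hi hi' k hl' (p t) t), smul_add, smul_mul_assoc,
    smul_comm _ (_ : ℤ), ← Fin.sum_univ_eq_sum_range, Fin.sum_univ_def]

theorem lb1_le {l : ℕ} (hl : 1 ≤ l) : C.lb1 l ≤ l := by
  have h := Nat.div_add_mod (l - 1) C.m
  unfold lb1
  generalize (l - 1) / C.m = a at *
  generalize (l - 1) % C.m = e at *
  rw [Nat.mul_comm] at h
  split_ifs
  · have : a / 2 * C.m ≤ a * C.m := Nat.mul_le_mul_right _ (Nat.div_le_self _ _)
    omega
  · have : (a + 1) / 2 * C.m ≤ a * C.m := Nat.mul_le_mul_right _ (by omega)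
    omega

theorem sum_range_ite_eq_add_one (x : ℤ) (z : ℂ) (a : ℕ) :
    ∑ t ∈ Finset.range a, (if x = (t : ℤ) + 1 then z else 0)
      = if 1 ≤ x ∧ x ≤ a then z else 0 := by
  induction a with
  | zero =>
    rw [Finset.sum_range_zero, if_neg]
    push_cast
    omega
  | succ a ih =>
    rw [Finset.sum_range_succ, ih]
    push_cast
    split_ifs <;> first | omega | simp

theorem sum_columnWeight (i : ℕ) (k : ℤ) {l : ℕ} (hl : 1 ≤ l) :
    ∑ t ∈ Finset.range l, C.columnWeight i k (C.lb1 l) t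
      = (if 1 ≤ k * (C.m : ℤ) + i ∧ k * (C.m : ℤ) + i ≤ C.lb1 l then 1 else 0)
        - (if 1 ≤ -(k * (C.m : ℤ)) - i + 1 ∧ -(k * (C.m : ℤ)) - i + 1 ≤ C.lb2 l
            then 1 else 0) := by
  have h : l = C.lb1 l + C.lb2 l := by
    have := C.lb1_le hl
    unfold lb2
    omega
  have h1 : ∑ t ∈ Finset.range (C.lb1 l), C.columnWeight i k (C.lb1 l) t
      = ∑ t ∈ Finset.range (C.lb1 l), (if k * C.m + i = (t : ℤ) + 1 then (1 : ℂ) else 0) :=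
    Finset.sum_congr rfl fun t ht => if_pos (Finset.mem_range.1 ht)
  have h2 : ∑ t ∈ Finset.range (C.lb2 l), C.columnWeight i k (C.lb1 l) (C.lb1 l + t)
      = ∑ t ∈ Finset.range (C.lb2 l),
          (if -(k * C.m) - i + 1 = (t : ℤ) + 1 then (-1 : ℂ) else 0) := by
    refine Finset.sum_congr rfl fun t _ => ?_
    rw [columnWeight, if_neg (by omega)]
    push_cast
    rw [add_sub_cancel_left]
  generalize C.lb1 l = a at *
  generalize C.lb2 l = e at *
  rw [h, Finset.sum_range_add, h1, h2, sum_range_ite_eq_add_one, sum_range_ite_eq_add_one,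
    sub_eq_add_neg]
  split_ifs <;> simp

theorem mem_Icc_of_mem_J {i : ℕ} (hi' : i ≤ C.m) {a l : ℕ} (ha : a ≤ l) {k : ℤ}
    (h : 1 ≤ k * (C.m : ℤ) + i ∧ k * (C.m : ℤ) + i ≤ a) : k ∈ Finset.Icc (-(l : ℤ)) l := by
  have hm : (0 : ℤ) < C.m := by exact_mod_cast C.hm
  have h0 : 0 ≤ k := by
    by_contra hk
    have : k * C.m ≤ -1 * C.m := mul_le_mul_of_nonneg_right (by omega) hm.le
    omega
  have : k * 1 ≤ k * C.m := mul_le_mul_of_nonneg_left (by omega) h0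
  rw [Finset.mem_Icc]
  omega

theorem mem_Icc_of_mem_Jbar {i : ℕ} (hi : 1 ≤ i) (hi' : i ≤ C.m) {a l : ℕ} (ha : a ≤ l) {k : ℤ}
    (h : 1 ≤ -(k * (C.m : ℤ)) - i + 1 ∧ -(k * (C.m : ℤ)) - i + 1 ≤ a) :
    k ∈ Finset.Icc (-(l : ℤ)) l := by
  have hm : (0 : ℤ) < C.m := by exact_mod_cast C.hm
  have h0 : k + 1 ≤ 0 := by
    by_contra hk
    have : 0 ≤ k * C.m := mul_nonneg (by omega) hm.le
    omega
  have : (k + 1) * C.m ≤ (k + 1) * 1 := mul_le_mul_of_nonpos_left (by omega) h0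
  rw [add_mul, one_mul] at this
  rw [Finset.mem_Icc]
  omega

theorem Jsum_eq_sum {i : ℕ} (hi' : i ≤ C.m) {a l : ℕ} (ha : a ≤ l) (b : ℤ) :
    C.Jsum i a b = ∑ k ∈ Finset.Icc (-(l : ℤ)) l,
      C.qp b k * (if 1 ≤ k * (C.m : ℤ) + i ∧ k * (C.m : ℤ) + i ≤ a then 1 else 0) := by
  rw [Jsum, finsum_mem_def, finsum_eq_sum_of_support_subset (s := Finset.Icc (-(l : ℤ)) l)]
  · exact Finset.sum_congr rfl fun k _ => by simp [Set.indicator_apply]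
  · intro k hk
    have h := Set.support_indicator_subset hk
    exact C.mem_Icc_of_mem_J hi' ha h

theorem Jbarsum_eq_sum {i : ℕ} (hi : 1 ≤ i) (hi' : i ≤ C.m) {a l : ℕ} (ha : a ≤ l) (b : ℤ) :
    C.Jbarsum i a b = ∑ k ∈ Finset.Icc (-(l : ℤ)) l,
      C.qp b k * (if 1 ≤ -(k * (C.m : ℤ)) - i + 1 ∧ -(k * (C.m : ℤ)) - i + 1 ≤ a
        then 1 else 0) := by
  rw [Jbarsum, finsum_mem_def, finsum_eq_sum_of_support_subset (s := Finset.Icc (-(l : ℤ)) l)]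
  · exact Finset.sum_congr rfl fun k _ => by simp [Set.indicator_apply]
  · intro k hk
    have h := Set.support_indicator_subset hk
    exact C.mem_Icc_of_mem_Jbar hi hi' ha h

/-- The mode of the current acts on `B_l|0⟩` by a scalar. -/
theorem currentMode_smul_Bdet_vac {i : ℕ} (hi : 1 ≤ i) (hi' : i ≤ C.m) (k : ℤ) {l : ℕ}
    (hl' : l ≤ C.n) :
    C.currentMode i k • C.Bdet l • C.vac
      = (∑ t ∈ Finset.range l, C.columnWeight i k (C.lb1 l) t
          + if k = 0 then C.eps * (C.n : ℂ) else 0) • C.Bdet l • C.vac := by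
  rw [← mul_smul, C.currentMode_mul_Bdet hi hi' k hl', add_smul, mul_smul,
    C.currentMode_vac hi hi', smul_assoc, add_smul, add_comm]
  congr 1
  rw [← algebraMap_smul C.W (_ : ℂ) C.vac, ← mul_smul, ← Algebra.commutes, mul_smul,
    algebraMap_smul]

theorem qp_zero_mul_eps (b : ℤ) : C.qp b 0 * C.eps = C.eps := by
  rcases C.hsig with h | h <;> simp [qp, eps, h]

end WCtx

open WCtx in
/-- **Lemma 5.18.**  For `1 ≤ i ≤ m`, `b ∈ ℤ`, let
`F_i(b) = Σ_{r∈S} q^{-br} Σ_{c=1}^n :ψ_i^c(-r)ψ̄_i^c(r): − n ω_S(b)`.  Then for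
`1 ≤ l ≤ n`:
`F_i(b)(B_l|0⟩) = (Σ_{r∈J^S_{i,l̄₁}} q^{-br} − Σ_{r∈J̄^S_{i,l̄₂}} q^{-br} + εn − nω_S(b)) B_l|0⟩`. -/
theorem statement18 (C : WCtx) (i : ℕ) (hi : 1 ≤ i) (hi' : i ≤ C.m) (b : ℤ)
    (l : ℕ) (hl : 1 ≤ l) (hl' : l ≤ C.n) :
    C.Eib i b (C.Bdet l • C.vac)
      = (C.Jsum i (C.lb1 l) b - C.Jbarsum i (C.lb2 l) b
          + C.eps * (C.n : ℂ) - (C.n : ℂ) * C.om b) • (C.Bdet l • C.vac) := by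
  have hlb2 : C.lb2 l ≤ l := Nat.sub_le l _
  have hsum := fun k => C.sum_columnWeight i k hl
  have hfin : ∑ k ∈ Finset.Icc (-(l : ℤ)) l,
      (C.qp b k * (∑ t ∈ Finset.range l, C.columnWeight i k (C.lb1 l) t
        + if k = 0 then C.eps * (C.n : ℂ) else 0))
      = C.Jsum i (C.lb1 l) b - C.Jbarsum i (C.lb2 l) b + C.eps * (C.n : ℂ) := by
    rw [C.Jsum_eq_sum hi' (C.lb1_le hl), C.Jbarsum_eq_sum hi hi' hlb2]
    simp only [hsum, mul_add, mul_sub, Finset.sum_add_distrib, Finset.sum_sub_distrib]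
    congr 1
    rw [Finset.sum_eq_single_of_mem 0 (by simp) fun k _ hk => by rw [if_neg hk, mul_zero],
      if_pos rfl, ← mul_assoc, C.qp_zero_mul_eps]
  have hterm : ∀ k : ℤ, (C.qp b k • ∑ c : Fin C.n,
      C.nord (C.psiS i ((c : ℕ) + 1) (-k - C.sig)) k (C.psibarS i ((c : ℕ) + 1) k))
        • C.Bdet l • C.vac
      = (C.qp b k * (∑ t ∈ Finset.range l, C.columnWeight i k (C.lb1 l) t
        + if k = 0 then C.eps * (C.n : ℂ) else 0)) • C.Bdet l • C.vac := fun k => by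
    rw [smul_assoc, mul_smul, ← C.currentMode_smul_Bdet_vac hi hi' k hl', currentMode]
  rw [Eib, sub_smul, ← hfin, Finset.sum_smul, finsum_congr hterm]
  congr 1
  refine finsum_eq_sum_of_support_subset _ fun k hk => ?_
  by_contra hk'
  refine hk ?_
  have h0 : k ≠ 0 := by
    rintro rfl
    simp at hk'
  dsimp only
  rw [hsum, if_neg fun h => hk' (C.mem_Icc_of_mem_J hi' (C.lb1_le hl) h),
    if_neg fun h => hk' (C.mem_Icc_of_mem_Jbar hi hi' hlb2 h), if_neg h0, sub_zero, add_zero,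
    mul_zero, zero_smul]
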